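/- arXiv:1211.3646 — 4 statements merged into one kernel-verified Lean document; each statement's English description precedes it below -/
import Mathlib

section
/- Let n ≥ 2 and let U ⊆ ℂⁿ be the set of tuples t = (t_1, …, t_n) with t_i ≠ 0, t_i ≠ 1 for all i, and t_i ≠ t_j for all i ≠ j. Define Γ : ℂⁿ ⇀ ℂⁿ by Γ(t)_i = t_n(t_i − 1)/(t_i − t_n) for 1 ≤ i ≤ n−1 and Γ(t)_n = t_n. Then Γ maps U into U, Γ(Γ(t)) = t for all t ∈ U, and consequently Γ restricts to a bijection of U onto itself. -/
/-- For `a ≠ 0, 1`, the Möbius transformation `x ↦ a(x-1)/(x-a)` is an involution away from its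
pole. -/
theorem mobius_involution {K : Type*} [Field K] {a x : K} (h0 : a ≠ 0) (h1 : a ≠ 1)
    (hx : x ≠ a) : a * (a * (x - 1) / (x - a) - 1) / (a * (x - 1) / (x - a) - a) = x := by
  have hxa : x - a ≠ 0 := sub_ne_zero.2 hx
  have ha : a - 1 ≠ 0 := sub_ne_zero.2 h1
  have hnum : a * (x - 1) / (x - a) - 1 = x * (a - 1) / (x - a) := by
    field_simp
    ring
  have hden : a * (x - 1) / (x - a) - a = a * (a - 1) / (x - a) := by
    field_simp
    ring
  rw [hnum, hden]
  field_simp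

theorem mobius_ne_zero {K : Type*} [Field K] {a x : K} (h0 : a ≠ 0) (hx1 : x ≠ 1)
    (hx : x ≠ a) : a * (x - 1) / (x - a) ≠ 0 :=
  div_ne_zero (mul_ne_zero h0 (sub_ne_zero.2 hx1)) (sub_ne_zero.2 hx)

theorem mobius_ne_one {K : Type*} [Field K] {a x : K} (h1 : a ≠ 1) (hx0 : x ≠ 0)
    (hx : x ≠ a) : a * (x - 1) / (x - a) ≠ 1 := by
  rw [Ne, div_eq_one_iff_eq (sub_ne_zero.2 hx)]
  intro h
  exact mul_ne_zero hx0 (sub_ne_zero.2 h1) (by linear_combination h)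

theorem mobius_ne_self {K : Type*} [Field K] {a x : K} (h0 : a ≠ 0) (h1 : a ≠ 1)
    (hx : x ≠ a) : a * (x - 1) / (x - a) ≠ a := by
  rw [Ne, div_eq_iff (sub_ne_zero.2 hx)]
  intro h
  exact mul_ne_zero h0 (sub_ne_zero.2 h1) (by linear_combination h)

/-- Let `U ⊆ ℂⁿ` be the set of tuples with coordinates different from `0`, `1` and
pairwise distinct. The rational map `Γ(t)ᵢ = tₙ(tᵢ-1)/(tᵢ-tₙ)` (for `i < n`),
`Γ(t)ₙ = tₙ` maps `U` into `U`, is an involution on `U`, and hence restricts to a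
bijection of `U` onto itself. -/
theorem gamma_involution (n : ℕ) (hn : 2 ≤ n) :
    letI U : Set (Fin n → ℂ) :=
      {t | (∀ i, t i ≠ 0 ∧ t i ≠ 1) ∧ ∀ i j, i ≠ j → t i ≠ t j}
    letI last : Fin n := ⟨n - 1, by omega⟩
    letI Γ : (Fin n → ℂ) → (Fin n → ℂ) := fun t i =>
      if i = last then t last else t last * (t i - 1) / (t i - t last)
    (∀ t ∈ U, Γ t ∈ U) ∧ (∀ t ∈ U, Γ (Γ t) = t) ∧ Set.BijOn Γ U U := by
  let U : Set (Fin n → ℂ) :=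
    {t | (∀ i, t i ≠ 0 ∧ t i ≠ 1) ∧ ∀ i j, i ≠ j → t i ≠ t j}
  let last : Fin n := ⟨n - 1, by omega⟩
  let Γ : (Fin n → ℂ) → (Fin n → ℂ) := fun t i =>
    if i = last then t last else t last * (t i - 1) / (t i - t last)
  change (∀ t ∈ U, Γ t ∈ U) ∧ (∀ t ∈ U, Γ (Γ t) = t) ∧ Set.BijOn Γ U U
  have hmaps : ∀ t ∈ U, Γ t ∈ U := by
    rintro t ⟨ht, hne⟩
    obtain ⟨h0, h1⟩ := ht last
    refine ⟨fun i => ?_, fun i j hij => ?_⟩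
    · by_cases hi : i = last
      · simp only [Γ, if_pos hi]
        exact ⟨h0, h1⟩
      · simp only [Γ, if_neg hi]
        exact ⟨mobius_ne_zero h0 (ht i).2 (hne i last hi),
          mobius_ne_one h1 (ht i).1 (hne i last hi)⟩
    · by_cases hi : i = last
      · have hj : j ≠ last := fun h => hij (hi.trans h.symm)
        simp only [Γ, if_pos hi, if_neg hj]
        exact (mobius_ne_self h0 h1 (hne j last hj)).symm
      · by_cases hj : j = last
        · simp only [Γ, if_neg hi, if_pos hj]
          exact mobius_ne_self h0 h1 (hne i last hi)
        · simp only [Γ, if_neg hi, if_neg hj]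
          intro h
          apply hne i j hij
          rw [← mobius_involution h0 h1 (hne i last hi), h,
            mobius_involution h0 h1 (hne j last hj)]
  have hinv : ∀ t ∈ U, Γ (Γ t) = t := by
    rintro t ⟨ht, hne⟩
    funext i
    by_cases hi : i = last
    · simp only [Γ, if_true, hi]
    · simp only [Γ, if_true, if_neg hi]
      exact mobius_involution (ht last).1 (ht last).2 (hne i last hi)
  exact ⟨hmaps, hinv, Set.InvOn.bijOn ⟨hinv, hinv⟩ hmaps hmaps⟩
end

section
/- Let n ≥ 2 and let t = (t_1, …, t_n) ∈ ℂⁿ satisfy t_i ∉ {0,1} for all i and t_i ≠ t_j for i ≠ j. Let A be the (n+1) × (n+3) complex matrix whose columns are, in order: v(0), v(t_1), …, v(t_{n−1}), eₙ₊₁ = (0,…,0,1)ᵗ, v(1), v(t_n), where v(x) = (1, x, x², …, xⁿ)ᵗ. Set s_i = t_n(t_i − 1)/(t_i − t_n) for 1 ≤ i ≤ n−1 and s_n = t_n, and let Std(s) be the (n+1) × (n+3) matrix [ I_{n+1} | 𝟙 | w ], where I_{n+1} is the identity matrix, 𝟙 = (1,…,1)ᵗ, and w = (1, s_1, …, s_n)ᵗ.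 Then there exist an invertible (n+1) × (n+1) complex matrix P and nonzero scalars c_1, …, c_{n+3} ∈ ℂ such that P · A = Std(s) · diag(c_1, …, c_{n+3}). -/
/-- The standard form `Std(s) = [ I_{n+1} | 𝟙 | (1, s₁, …, sₙ)ᵗ ]` of an
`(n+1) × (n+3)` matrix of defining linear forms of a hyperplane arrangement. -/
def Std (n : ℕ) (s : Fin n → ℂ) : Matrix (Fin (n + 1)) (Fin (n + 3)) ℂ :=
  Matrix.of fun i j =>
    if (j : ℕ) < n + 1 then (if (i : ℕ) = (j : ℕ) then 1 else 0)
    else if (j : ℕ) = n + 1 then 1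
    else if h : (i : ℕ) = 0 then 1
    else s ⟨(i : ℕ) - 1, by have := i.2; omega⟩

open Polynomial in
/-- The polynomial of degree `#((range n).erase i)` that vanishes at `p j` for `j < n`, `j ≠ i`,
and takes the value `1` at `1`. -/
noncomputable def nodePoly (p : ℕ → ℂ) (n i : ℕ) : ℂ[X] :=
  ∏ j ∈ (Finset.range n).erase i, C (1 - p j)⁻¹ * (X - C (p j))

section nodePoly

open Polynomial

variable {p : ℕ → ℂ} {n i : ℕ}

lemma eval_nodePoly (x : ℂ) :
    (nodePoly p n i).eval x = ∏ j ∈ (Finset.range n).erase i, (1 - p j)⁻¹ * (x - p j) := by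
  simp [nodePoly, eval_prod]

lemma natDegree_nodePoly_le : (nodePoly p n i).natDegree ≤ ((Finset.range n).erase i).card := by
  refine (natDegree_prod_le _ _).trans ((Finset.sum_le_card_nsmul _ _ 1 fun j _ => ?_).trans ?_)
  · exact (natDegree_C_mul_le _ _).trans (natDegree_X_sub_C_le _)
  · simp

lemma natDegree_nodePoly_lt_succ : (nodePoly p n i).natDegree < n + 1 := by
  have := (Finset.range n).card_erase_le (a := i)
  rw [Finset.card_range] at this
  exact Nat.lt_succ_of_le (natDegree_nodePoly_le.trans this)

lemma sum_coeff_nodePoly_mul_pow (x : ℂ) :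
    ∑ k : Fin (n + 1), (nodePoly p n i).coeff k * x ^ (k : ℕ) = (nodePoly p n i).eval x := by
  rw [eval_eq_sum_range' natDegree_nodePoly_lt_succ, Finset.sum_range]

lemma coeff_nodePoly_of_lt (hi : i < n) : (nodePoly p n i).coeff n = 0 := by
  refine coeff_eq_zero_of_natDegree_lt (natDegree_nodePoly_le.trans_lt ?_)
  rw [Finset.card_erase_of_mem (Finset.mem_range.2 hi), Finset.card_range]
  omega

lemma coeff_nodePoly_self_ne_zero (h1 : ∀ j < n, p j ≠ 1) : (nodePoly p n n).coeff n ≠ 0 := by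
  have h : (nodePoly p n n).coeff n = ∏ j ∈ Finset.range n, (1 - p j)⁻¹ := by
    have := coeff_prod_of_natDegree_le (s := Finset.range n)
      (fun j => C (1 - p j)⁻¹ * (X - C (p j))) 1
      fun j _ => (natDegree_C_mul_le _ _).trans (natDegree_X_sub_C_le _)
    simpa [nodePoly, coeff_X, coeff_C] using this
  rw [h, Finset.prod_ne_zero_iff]
  exact fun j hj => inv_ne_zero (sub_ne_zero.2 (h1 j (Finset.mem_range.1 hj)).symm)

lemma eval_nodePoly_of_ne {j : ℕ} (hj : j < n) (hij : i ≠ j) :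
    (nodePoly p n i).eval (p j) = 0 := by
  rw [eval_nodePoly]
  exact Finset.prod_eq_zero (Finset.mem_erase.2 ⟨hij.symm, Finset.mem_range.2 hj⟩) (by simp)

lemma eval_nodePoly_ne_zero (h1 : ∀ j < n, p j ≠ 1) {x : ℂ} (hx : ∀ j < n, j ≠ i → x ≠ p j) :
    (nodePoly p n i).eval x ≠ 0 := by
  rw [eval_nodePoly, Finset.prod_ne_zero_iff]
  intro j hj
  obtain ⟨hji, hj⟩ := Finset.mem_erase.1 hj
  have hj := Finset.mem_range.1 hj
  exact mul_ne_zero (inv_ne_zero (sub_ne_zero.2 (h1 j hj).symm)) (sub_ne_zero.2 (hx j hj hji))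

lemma eval_one_nodePoly (h1 : ∀ j < n, p j ≠ 1) : (nodePoly p n i).eval 1 = 1 := by
  rw [eval_nodePoly]
  refine Finset.prod_eq_one fun j hj => inv_mul_cancel₀ (sub_ne_zero.2 (h1 j ?_).symm)
  exact Finset.mem_range.1 (Finset.mem_of_mem_erase hj)

lemma eval_nodePoly_mul (hi : i < n) (x : ℂ) :
    (nodePoly p n i).eval x * ((1 - p i)⁻¹ * (x - p i)) = (nodePoly p n n).eval x := by
  rw [eval_nodePoly, eval_nodePoly, Finset.prod_erase_mul _ _ (Finset.mem_range.2 hi),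
    Finset.erase_eq_of_notMem Finset.notMem_range_self]

end nodePoly

lemma Std_apply_of_lt {n : ℕ} (s : Fin n → ℂ) (i : Fin (n + 1)) {j : Fin (n + 3)}
    (hj : (j : ℕ) < n + 1) : Std n s i j = if (i : ℕ) = j then 1 else 0 :=
  if_pos hj

/-- A matrix sending the columns of another matrix to nonzero multiples of the standard form
is invertible. -/
lemma isUnit_of_mul_eq_Std_mul_diagonal {n : ℕ} {P : Matrix (Fin (n + 1)) (Fin (n + 1)) ℂ}
    {A : Matrix (Fin (n + 1)) (Fin (n + 3)) ℂ} {s : Fin n → ℂ} {c : Fin (n + 3) → ℂ}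
    (hc : ∀ j, c j ≠ 0) (h : P * A = Std n s * Matrix.diagonal c) : IsUnit P := by
  let e : Fin (n + 1) → Fin (n + 3) := Fin.castLE (by omega)
  refine IsUnit.of_mul_eq_one (Matrix.of fun i j => A i (e j) * (c (e j))⁻¹) ?_
  ext i j
  have hij := congrFun (congrFun h i) (e j)
  rw [Matrix.mul_diagonal, Std_apply_of_lt s i (j := e j) j.2, Matrix.mul_apply] at hij
  simp only [Matrix.mul_apply, Matrix.of_apply, ← mul_assoc]
  rw [← Finset.sum_mul, hij, mul_assoc, mul_inv_cancel₀ (hc _), mul_one, Matrix.one_apply]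
  simp [e, Fin.ext_iff]

/-- Claim 3.6: the Vandermonde-type matrix `A` with columns
`v(0), v(t₁), …, v(t_{n-1}), e_{n+1}, v(1), v(tₙ)` (where `v(x) = (1,x,…,xⁿ)ᵗ`)
is transformed, by an invertible matrix `P` acting on the left and nonzero
rescaling of the columns, into the standard form `Std(s)` with
`sᵢ = tₙ(tᵢ-1)/(tᵢ-tₙ)` for `i < n` and `sₙ = tₙ`. -/
theorem vandermonde_arrangement_normal_form (n : ℕ) (hn : 2 ≤ n) (t : Fin n → ℂ)
    (ht : ∀ i, t i ≠ 0 ∧ t i ≠ 1) (ht' : ∀ i j, i ≠ j → t i ≠ t j) :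
    letI tn : ℂ := t ⟨n - 1, by omega⟩
    letI A : Matrix (Fin (n + 1)) (Fin (n + 3)) ℂ := Matrix.of fun i j =>
      if (j : ℕ) = 0 then (0 : ℂ) ^ (i : ℕ)
      else if h : (j : ℕ) ≤ n - 1 then (t ⟨(j : ℕ) - 1, by omega⟩) ^ (i : ℕ)
      else if (j : ℕ) = n then (if (i : ℕ) = n then 1 else 0)
      else if (j : ℕ) = n + 1 then 1
      else tn ^ (i : ℕ)
    letI s : Fin n → ℂ := fun k =>
      if (k : ℕ) < n - 1 then tn * (t k - 1) / (t k - tn) else tn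
    ∃ P : Matrix (Fin (n + 1)) (Fin (n + 1)) ℂ, IsUnit P ∧
      ∃ c : Fin (n + 3) → ℂ, (∀ j, c j ≠ 0) ∧
        P * A = Std n s * Matrix.diagonal c := by
  let tn : ℂ := t ⟨n - 1, by omega⟩
  let A : Matrix (Fin (n + 1)) (Fin (n + 3)) ℂ := Matrix.of fun i j =>
    if (j : ℕ) = 0 then (0 : ℂ) ^ (i : ℕ)
    else if h : (j : ℕ) ≤ n - 1 then (t ⟨(j : ℕ) - 1, by omega⟩) ^ (i : ℕ)
    else if (j : ℕ) = n then (if (i : ℕ) = n then 1 else 0)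
    else if (j : ℕ) = n + 1 then 1
    else tn ^ (i : ℕ)
  let s : Fin n → ℂ := fun k =>
    if (k : ℕ) < n - 1 then tn * (t k - 1) / (t k - tn) else tn
  have hn0 : 0 < n := by omega
  let p : ℕ → ℂ := fun j => if h : 0 < j ∧ j < n then t ⟨j - 1, by omega⟩ else 0
  have hp0 : p 0 = 0 := by simp [p]
  have hp : ∀ j (hj : 0 < j ∧ j < n), p j = t ⟨j - 1, by omega⟩ := fun j hj => by simp [p, hj]
  have h1 : ∀ j < n, p j ≠ 1 := by
    intro j hj
    rcases j.eq_zero_or_pos with rfl | h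
    · simp [hp0]
    · rw [hp j ⟨h, hj⟩]
      exact (ht _).2
  have htn : ∀ j < n, tn ≠ p j := by
    intro j hj
    rcases j.eq_zero_or_pos with rfl | h
    · rw [hp0]
      exact (ht _).1
    · rw [hp j ⟨h, hj⟩]
      exact ht' _ _ (by simp only [ne_eq, Fin.mk.injEq]; omega)
  have hinj : ∀ i < n, ∀ j < n, j ≠ i → p i ≠ p j := by
    intro i hi j hj hji
    rcases i.eq_zero_or_pos with rfl | hi0
    · rw [hp0, hp j ⟨by omega, hj⟩]
      exact (ht _).1.symm
    · rcases j.eq_zero_or_pos with rfl | hj0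
      · rw [hp0, hp i ⟨by omega, hi⟩]
        exact (ht _).1
      · rw [hp i ⟨hi0, hi⟩, hp j ⟨hj0, hj⟩]
        exact ht' _ _ (by simp only [ne_eq, Fin.mk.injEq]; omega)
  let P : Matrix (Fin (n + 1)) (Fin (n + 1)) ℂ := Matrix.of fun i k => (nodePoly p n i).coeff k
  let c : Fin (n + 3) → ℂ := fun j =>
    if (j : ℕ) < n then (nodePoly p n j).eval (p j)
    else if (j : ℕ) = n then (nodePoly p n n).coeff n
    else if (j : ℕ) = n + 1 then 1
    else (nodePoly p n 0).eval tn
  have hc : ∀ j, c j ≠ 0 := by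
    intro j
    simp only [c]
    split_ifs with hj
    · exact eval_nodePoly_ne_zero h1 (hinj j hj)
    · exact coeff_nodePoly_self_ne_zero h1
    · exact one_ne_zero
    · exact eval_nodePoly_ne_zero h1 fun j hj _ => htn j hj
  have key : P * A = Std n s * Matrix.diagonal c := by
    ext i j
    have hPA : ∀ x : ℂ, (∀ k, A k j = x ^ (k : ℕ)) → (P * A) i j = (nodePoly p n i).eval x := by
      intro x hx
      simp only [Matrix.mul_apply, hx, P, Matrix.of_apply]
      exact sum_coeff_nodePoly_mul_pow x
    rw [Matrix.mul_diagonal]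
    have hjlt := j.2
    have hilt := i.2
    rcases lt_trichotomy (j : ℕ) n with hj | hj | hj
    · rw [hPA (p j), Std_apply_of_lt s i (by omega)]
      · simp only [c, hj, if_true]
        split_ifs with hij
        · rw [hij, one_mul]
        · rw [zero_mul, eval_nodePoly_of_ne hj hij]
      · intro k
        rcases (j : ℕ).eq_zero_or_pos with h | h
        · simp only [A, Matrix.of_apply, h, if_true, hp0]
        · simp only [A, Matrix.of_apply, if_neg h.ne', dif_pos (Nat.le_sub_one_of_lt hj), hp j ⟨h, hj⟩]
    · rw [Std_apply_of_lt s i (by omega)]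
      have hA : ∀ k, A k j = if k = Fin.last n then 1 else 0 := by
        intro k
        simp only [A, Matrix.of_apply, hj, if_neg hn0.ne', dif_neg (show ¬ n ≤ n - 1 by omega), if_true,
          Fin.ext_iff, Fin.val_last]
      simp only [Matrix.mul_apply, hA, mul_ite, mul_one, mul_zero, Finset.sum_ite_eq',
        Finset.mem_univ, if_true, P, Matrix.of_apply, Fin.val_last, c, hj, lt_irrefl, if_false]
      split_ifs with hin
      · rw [hin, one_mul]
      · rw [zero_mul, coeff_nodePoly_of_lt (by omega)]
    · rcases (show (j : ℕ) = n + 1 ∨ (j : ℕ) = n + 2 by omega) with hj | hj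
      · rw [hPA 1, eval_one_nodePoly h1]
        · simp [Std, c, hj]
        · intro k
          simp only [A, Matrix.of_apply]
          rw [if_neg (by omega), dif_neg (by omega), if_neg (by omega), if_pos hj, one_pow]
      · rw [hPA tn]
        · have hcj : c j = (nodePoly p n 0).eval tn := by simp [c, hj]
          have h0 := eval_nodePoly_mul (p := p) hn0 tn
          rw [hp0, sub_zero, inv_one, one_mul, sub_zero] at h0
          rw [hcj]
          rcases (i : ℕ).eq_zero_or_pos with hi | hi
          · have hS : Std n s i j = 1 := by
              simp only [Std, Matrix.of_apply]
              rw [if_neg (by omega), if_neg (by omega), dif_pos hi]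
            rw [hS, hi, one_mul]
          · have hS : Std n s i j = s ⟨i - 1, by omega⟩ := by
              simp only [Std, Matrix.of_apply]
              rw [if_neg (by omega), if_neg (by omega), dif_neg hi.ne']
            rw [hS]
            rcases (show (i : ℕ) < n ∨ (i : ℕ) = n by omega) with hin | hin
            · have hsi : s ⟨i - 1, by omega⟩ = tn * (p i - 1) / (p i - tn) := by
                simp only [s, hp i ⟨hi, hin⟩]
                rw [if_pos (by omega)]
              have hi' := eval_nodePoly_mul (p := p) hin tn
              have ha : 1 - p i ≠ 0 := sub_ne_zero.2 (h1 i hin).symm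
              have hb : p i - tn ≠ 0 := sub_ne_zero.2 (htn i hin).symm
              rw [← h0] at hi'
              rw [hsi, div_mul_eq_mul_div, eq_div_iff hb]
              field_simp at hi'
              linear_combination -hi'
            · have hsi : s ⟨i - 1, by omega⟩ = tn := by
                simp only [s]
                rw [if_neg (by omega)]
              rw [hsi, hin, ← h0, mul_comm]
        · intro k
          simp only [A, Matrix.of_apply]
          rw [if_neg (by omega), dif_neg (by omega), if_neg (by omega), if_neg (by omega)]
  exact ⟨P, isUnit_of_mul_eq_Std_mul_diagonal hc key, c, hc, key⟩
end

section
/- Let r ≥ 1, m ≥ 2, and let B be a 2 × m complex matrix such that any two distinct columns of B are linearly independent. Suppose z = (z_1, …, z_m) ∈ ℂᵐ is nonzero and satisfies Σ_{j=1}^m b_{ij} z_j^r = 0 for i = 1, 2. Then the 2 × m matrix J with entries J_{ij} = b_{ij} z_j^{r−1} has rank 2. -/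
/-- If any two distinct columns of the `2 × m` matrix `B` are linearly independent and
`z ≠ 0` satisfies the two equations `∑ⱼ bᵢⱼ zⱼʳ = 0` (`i = 1, 2`), then the Jacobian-type
matrix `J` with entries `Jᵢⱼ = bᵢⱼ zⱼ^{r-1}` has rank `2`. -/
theorem jacobian_rank_two (r m : ℕ) (hr : 1 ≤ r) (hm : 2 ≤ m)
    (B : Matrix (Fin 2) (Fin m) ℂ)
    (hB : ∀ j k : Fin m, j ≠ k →
      LinearIndependent ℂ ![(fun i => B i j : Fin 2 → ℂ), (fun i => B i k : Fin 2 → ℂ)])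
    (z : Fin m → ℂ) (hz : z ≠ 0)
    (heq : ∀ i : Fin 2, ∑ j, B i j * z j ^ r = 0) :
    (Matrix.of fun i j => B i j * z j ^ (r - 1) : Matrix (Fin 2) (Fin m) ℂ).rank = 2 := by
  have exists_pair : ∃ j k, j ≠ k ∧ z j ≠ 0 ∧ z k ≠ 0 := by
    obtain ⟨j, hj⟩ := Function.ne_iff.mp hz
    by_contra! h
    have hz0 : ∀ k, k ≠ j → z k = 0 := fun k hk => h j k hk.symm hj
    have : Nontrivial (Fin m) := Fin.nontrivial_iff_two_le.mpr hm
    obtain ⟨k, hk⟩ := exists_ne j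
    refine (hB j k hk.symm).ne_zero 0 (funext fun i => ?_)
    have hi := heq i
    rw [Finset.sum_eq_single j (fun l _ hl => by rw [hz0 l hl, zero_pow (by lia), mul_zero])
      (fun hj' => absurd (Finset.mem_univ j) hj')] at hi
    exact (mul_eq_zero.mp hi).resolve_right (pow_ne_zero r hj)
  obtain ⟨j, k, hjk, hj, hk⟩ := exists_pair
  have hunit : IsUnit (Matrix.of ![(fun i => B i j : Fin 2 → ℂ), (fun i => B i k)]) :=
    Matrix.linearIndependent_rows_iff_isUnit.mp (hB j k hjk)
  rw [LinearIndependent.rank_matrix, Fintype.card_fin]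
  rw [Fintype.linearIndependent_iff]
  intro g hg
  have hcol : ∀ l, z l ≠ 0 → B 0 l * g 0 + B 1 l * g 1 = 0 := by
    intro l hl
    have hgl := congrFun hg l
    simp only [Fin.sum_univ_two, Matrix.row_apply, Matrix.of_apply, Pi.add_apply, Pi.smul_apply,
      smul_eq_mul, Pi.zero_apply] at hgl
    refine (mul_eq_zero.mp ?_).resolve_right (pow_ne_zero (r - 1) hl)
    linear_combination hgl
  suffices hg0 : g = 0 from fun i => congrFun hg0 i
  apply Matrix.mulVec_injective_of_isUnit hunit
  ext i
  fin_cases i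
  · simpa [Matrix.mulVec, dotProduct, Fin.sum_univ_two] using hcol j hj
  · simpa [Matrix.mulVec, dotProduct, Fin.sum_univ_two] using hcol k hk
end

section
/- Let n ≥ 1 and s = (s_1, …, s_n) ∈ ℂⁿ, and let Std(s) be the (n+1) × (n+3) complex matrix [ I_{n+1} | 𝟙 | w ], where I_{n+1} is the identity matrix, 𝟙 = (1, …, 1)ᵗ, and w = (1, s_1, …, s_n)ᵗ. Then every (n+1) × (n+1) submatrix of Std(s) obtained by choosing n+1 of its n+3 columns is invertible if and only if s_i ≠ 0 and s_i ≠ 1 for all i and s_i ≠ s_j for all i ≠ j. -/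
open scoped Matrix

/-- All maximal square submatrices obtained by choosing columns of `A` are invertible iff every
nontrivial combination of the rows of `A` has more than `N - r` nonzero entries. -/
theorem forall_isUnit_submatrix_iff {K : Type*} [Field K] [DecidableEq K] {r N : ℕ}
    (A : Matrix (Fin r) (Fin N) K) :
    (∀ g : Fin r → Fin N, Function.Injective g → IsUnit (A.submatrix id g)) ↔
      ∀ v : Fin r → K, v ≠ 0 → N < r + (Finset.univ.filter fun j => (v ᵥ* A) j ≠ 0).card := by
  constructor
  · intro h v hv
    by_contra! hlt
    set T := Finset.univ.filter fun j => (v ᵥ* A) j ≠ 0 with hT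
    have hcard : r ≤ Tᶜ.card := by
      rw [Finset.card_compl, Fintype.card_fin]
      omega
    let g := Tᶜ.orderEmbOfCardLe hcard
    have hg : ∀ k, (v ᵥ* A) (g k) = 0 := fun k => by
      have hmem : g k ∈ Tᶜ := Tᶜ.orderEmbOfCardLe_mem hcard k
      rw [Finset.mem_compl, hT, Finset.mem_filter_univ] at hmem
      exact not_not.1 hmem
    refine hv (Matrix.vecMul_injective_of_isUnit (h g g.injective) ?_)
    ext k
    simpa [Matrix.vecMul, dotProduct] using hg k
  · intro h g hg
    rw [← Matrix.vecMul_injective_iff_isUnit]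
    refine (injective_iff_map_eq_zero (Matrix.vecMulLinear (A.submatrix id g))).2 fun v hv => ?_
    by_contra hne
    have hlt := h v hne
    have hdisj : Disjoint (Finset.univ.image g)
        (Finset.univ.filter fun j => (v ᵥ* A) j ≠ 0) := by
      rw [Finset.disjoint_left]
      intro j hj
      obtain ⟨k, -, rfl⟩ := Finset.mem_image.1 hj
      simpa [Matrix.vecMul, dotProduct] using congrFun hv k
    have hle := Finset.card_le_univ (Finset.univ.image g ∪
      Finset.univ.filter fun j => (v ᵥ* A) j ≠ 0)
    rw [Finset.card_union_of_disjoint hdisj, Finset.card_image_of_injective _ hg,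
      Finset.card_univ, Fintype.card_fin, Fintype.card_fin] at hle
    omega

section Std

variable {n : ℕ} (s : Fin n → ℂ) (v : Fin (n + 1) → ℂ)

theorem vecMul_Std_castAdd (i : Fin (n + 1)) : (v ᵥ* Std n s) (i.castAdd 2) = v i := by
  have hi : (i : ℕ) < n + 1 := i.2
  simp only [Matrix.vecMul, dotProduct, Std, Matrix.of_apply, Fin.val_castAdd, if_pos hi]
  simp [← Fin.ext_iff]

theorem vecMul_Std_natAdd_zero : (v ᵥ* Std n s) (Fin.natAdd (n + 1) (0 : Fin 2)) = ∑ i, v i := by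
  simp [Matrix.vecMul, dotProduct, Std]

theorem vecMul_Std_natAdd_one :
    (v ᵥ* Std n s) (Fin.natAdd (n + 1) (1 : Fin 2)) = ∑ i, v i * (Fin.cons 1 s : Fin (n + 1) → ℂ) i := by
  simp [Matrix.vecMul, dotProduct, Std, Fin.sum_univ_succ]

theorem card_support_vecMul_Std :
    (Finset.univ.filter fun j => (v ᵥ* Std n s) j ≠ 0).card =
      (Finset.univ.filter fun i => v i ≠ 0).card + (if ∑ i, v i ≠ 0 then 1 else 0) +
        if ∑ i, v i * (Fin.cons 1 s : Fin (n + 1) → ℂ) i ≠ 0 then 1 else 0 := by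
  rw [Finset.card_filter, Finset.card_filter,
    Fin.sum_univ_add (a := n + 1) (b := 2) fun j => if (v ᵥ* Std n s) j ≠ 0 then 1 else 0,
    Fin.sum_univ_two, vecMul_Std_natAdd_zero, vecMul_Std_natAdd_one, add_assoc]
  simp only [vecMul_Std_castAdd]

end Std

theorem two_lt_card_support_add_iff {m : ℕ} (w : Fin m → ℂ) :
    (∀ v : Fin m → ℂ, v ≠ 0 → 2 < (Finset.univ.filter fun i => v i ≠ 0).card +
        (if ∑ i, v i ≠ 0 then 1 else 0) + if ∑ i, v i * w i ≠ 0 then 1 else 0) ↔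
      (∀ i, w i ≠ 0) ∧ Function.Injective w := by
  constructor
  · intro h
    refine ⟨fun i hi => ?_, fun i j hij => ?_⟩
    · have := h (Pi.single i 1) (by simp)
      simp [Pi.single_apply, hi, Finset.filter_eq'] at this
    · by_contra hne
      have hv : (Pi.single i 1 - Pi.single j 1 : Fin m → ℂ) ≠ 0 := fun h0 => by
        simpa [hne] using congrFun h0 i
      have := h _ hv
      have hsub : (Finset.univ.filter fun k =>
          (Pi.single i 1 - Pi.single j 1 : Fin m → ℂ) k ≠ 0) ⊆ {i, j} := by
        intro k hk
        by_contra hk'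
        simp only [Finset.mem_insert, Finset.mem_singleton, not_or] at hk'
        simp [hk'.1, hk'.2] at hk
      have hle := (Finset.card_le_card hsub).trans Finset.card_le_two
      have h₁ : ∑ k, (Pi.single i 1 - Pi.single j 1 : Fin m → ℂ) k = 0 := by simp
      have h₂ : ∑ k, (Pi.single i 1 - Pi.single j 1 : Fin m → ℂ) k * w k = 0 := by
        simp [sub_mul, Pi.single_apply, hij]
      rw [h₁, h₂] at this
      simp only [ne_eq, not_true_eq_false, if_false, add_zero] at this
      exact absurd this (not_lt.2 hle)
  · rintro ⟨h0, hinj⟩ v hv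
    set S := Finset.univ.filter fun i => v i ≠ 0 with hS
    have hsum : ∀ f : Fin m → ℂ, ∑ i, v i * f i = ∑ i ∈ S, v i * f i := fun f =>
      (Finset.sum_filter_of_ne fun i _ hi => left_ne_zero_of_mul hi).symm
    have hsum₁ : ∑ i, v i = ∑ i ∈ S, v i := by simpa using hsum 1
    have hmem : ∀ i, i ∈ S ↔ v i ≠ 0 := by simp [hS]
    have hpos : 0 < S.card := by
      obtain ⟨i, hi⟩ := Function.ne_iff.1 hv
      exact Finset.card_pos.2 ⟨i, (hmem i).2 hi⟩
    rw [hsum, hsum₁]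
    obtain h1 | h2 | h3 : S.card = 1 ∨ S.card = 2 ∨ 2 < S.card := by omega
    · obtain ⟨i, hi⟩ := Finset.card_eq_one.1 h1
      have hvi : v i ≠ 0 := (hmem i).1 (by simp [hi])
      simp [hi, hvi, h0 i]
    · obtain ⟨i, j, hij, hSij⟩ := Finset.card_eq_two.1 h2
      have hvi : v i ≠ 0 := (hmem i).1 (by simp [hSij])
      have key : v i + v j ≠ 0 ∨ v i * w i + v j * w j ≠ 0 := by
        by_contra! hc
        refine hij (hinj (sub_eq_zero.1 ((mul_eq_zero.1 ?_).resolve_left hvi)))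
        linear_combination hc.2 - w j * hc.1
      rw [h2, hSij, Finset.sum_pair hij, Finset.sum_pair hij]
      rcases key with hk | hk <;> rw [if_pos hk] <;> omega
    · omega

/-- Every `(n+1) × (n+1)` submatrix of `Std(s)` obtained by choosing `n+1` of its `n+3`
columns is invertible iff `sᵢ ∉ {0, 1}` for all `i` and the `sᵢ` are pairwise distinct. -/
theorem std_general_position_iff (n : ℕ) (hn : 1 ≤ n) (s : Fin n → ℂ) :
    (∀ g : Fin (n + 1) → Fin (n + 3), Function.Injective g →
        IsUnit ((Std n s).submatrix id g)) ↔
      (∀ i, s i ≠ 0 ∧ s i ≠ 1) ∧ ∀ i j, i ≠ j → s i ≠ s j := by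
  rw [forall_isUnit_submatrix_iff]
  simp only [card_support_vecMul_Std]
  have hiff := two_lt_card_support_add_iff (Fin.cons 1 s : Fin (n + 1) → ℂ)
  rw [Fin.cons_injective_iff, Fin.forall_fin_succ] at hiff
  simp only [Fin.cons_zero, Fin.cons_succ, Set.mem_range, not_exists] at hiff
  have harith : ∀ c : ℕ, n + 3 < n + 1 + c ↔ 2 < c := by omega
  simp only [harith, hiff, Function.Injective]
  grind
end
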